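/- Let X be a discrete random variable taking values x_1,…,x_n in the interval [m,M] with probabilities p_1,…,p_n. Then μ₄ ≤ (μ₁'−m)(M−μ₁')·((μ₁'−m)² + (M−μ₁')² − (μ₁'−m)(M−μ₁')). -/

import Mathlib

/-- On `[-a, b]` the function `y ↦ y ^ 4` lies below its chord. -/
theorem pow_four_le_chord {a b y : ℝ} (hay : -a ≤ y) (hyb : y ≤ b) :
    y ^ 4 ≤ a * b * (a ^ 2 + b ^ 2 - a * b) + y * ((b - a) * (a ^ 2 + b ^ 2)) := by
  have hquad : 0 ≤ y ^ 2 + (b - a) * y + (a ^ 2 + b ^ 2 - a * b) := by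
    nlinarith [sq_nonneg (2 * y + b - a), sq_nonneg (a - b), sq_nonneg a, sq_nonneg b]
  have hprod := mul_nonneg
    (mul_nonneg (by linarith : 0 ≤ y + a) (by linarith : 0 ≤ b - y)) hquad
  linear_combination hprod

/-- Inequality (2.3): the fourth central moment of a discrete random variable
taking values in `[m, M]` satisfies
`μ₄ ≤ (μ₁'−m)(M−μ₁')((μ₁'−m)² + (M−μ₁')² − (μ₁'−m)(M−μ₁'))`. -/
theorem fourth_central_moment_le_of_mean {n : ℕ} (p x : Fin n → ℝ) (m M : ℝ)
    (hp : ∀ i, 0 ≤ p i) (hp1 : ∑ i, p i = 1)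
    (hx : ∀ i, x i ∈ Set.Icc m M)
    (μ : ℝ) (hμ : μ = ∑ i, p i * x i)
    (μ₄ : ℝ) (hμ₄ : μ₄ = ∑ i, p i * (x i - μ) ^ 4) :
    μ₄ ≤ (μ - m) * (M - μ) *
      ((μ - m) ^ 2 + (M - μ) ^ 2 - (μ - m) * (M - μ)) := by
  have hmean : ∑ i, p i * (x i - μ) = 0 := by
    simp only [mul_sub, Finset.sum_sub_distrib, ← Finset.sum_mul, hp1, ← hμ]
    ring
  calc
    μ₄ = ∑ i, p i * (x i - μ) ^ 4 := hμ₄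
    _ ≤ ∑ i, p i * ((μ - m) * (M - μ) * ((μ - m) ^ 2 + (M - μ) ^ 2 - (μ - m) * (M - μ)) +
          (x i - μ) * (((M - μ) - (μ - m)) * ((μ - m) ^ 2 + (M - μ) ^ 2))) :=
      Finset.sum_le_sum fun i _ => mul_le_mul_of_nonneg_left
        (pow_four_le_chord (by linarith [(hx i).1]) (by linarith [(hx i).2])) (hp i)
    _ = (μ - m) * (M - μ) * ((μ - m) ^ 2 + (M - μ) ^ 2 - (μ - m) * (M - μ)) := by
      simp only [mul_add, ← mul_assoc, Finset.sum_add_distrib, ← Finset.sum_mul, hp1, hmean]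
      ring
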